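/- arXiv:1810.04558 — 2 statements merged into one kernel-verified Lean document; each statement's English description precedes it below -/
import Mathlib

section
/- Let d ≥ 1 and let α ∈ ℝ^d satisfy ω^×(α) < d/(d−1) (for d = 1 this condition reads ω^×(α) < ∞). Then there exists a constant c > 0, depending only on α, such that for every γ ∈ ℝ^d the uniform simultaneous inhomogeneous exponent satisfies ω̂(α, γ) ≥ c. -/
open scoped BigOperators
open Filter MeasureTheory

/-- Distance from `x` to the nearest integer. -/
noncomputable def dn (x : ℝ) : ℝ := |x - round x|

/-- Multiplicative exponent `ω^×(α)`: the supremum of the set of real numbers `w` such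
that `‖nα₁‖⋯‖nα_d‖ < n^{-w}` holds for infinitely many `n ∈ ℕ`. -/
noncomputable def multExp {d : ℕ} (α : Fin d → ℝ) : EReal :=
  sSup {w : EReal | ∃ v : ℝ, w = (v : ℝ) ∧
    {n : ℕ | 0 < n ∧ ∏ i, dn (n * α i) < (n : ℝ) ^ (-v)}.Infinite}

/-- Uniform simultaneous inhomogeneous exponent `ω̂(α, γ)`: the supremum of the reals `w`
such that for every sufficiently large real `X` there is `n ∈ ℕ` with `n < X` and
`‖nα_i - γ_i‖ < X^{-w}` for all `i`. -/
noncomputable def unifExp {d : ℕ} (α γ : Fin d → ℝ) : EReal :=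
  sSup {w : EReal | ∃ v : ℝ, w = (v : ℝ) ∧
    ∃ X0 : ℝ, ∀ X : ℝ, X0 ≤ X → ∃ n : ℕ, 0 < n ∧ (n : ℝ) < X ∧
      ∀ i, dn (n * α i - γ i) < X ^ (-v)}

theorem dn_nonneg (x : ℝ) : 0 ≤ dn x := abs_nonneg _

theorem dn_le_abs_sub_intCast (x : ℝ) (p : ℤ) : dn x ≤ |x - p| := round_le x p

theorem dn_le_half (x : ℝ) : dn x ≤ 1 / 2 := abs_sub_round x

theorem dn_neg (x : ℝ) : dn (-x) = dn x := by
  apply le_antisymm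
  · refine (dn_le_abs_sub_intCast (-x) (-round x)).trans_eq ?_
    rw [dn, ← abs_neg]
    push_cast
    ring_nf
  · refine (dn_le_abs_sub_intCast x (-round (-x))).trans_eq ?_
    rw [dn, ← abs_neg]
    push_cast
    ring_nf

/-- Simultaneous Dirichlet approximation. -/
theorem exists_simultaneous_approx {ι : Type*} [Fintype ι] (β : ι → ℝ) (R : ℕ) (hR : 0 < R) :
    ∃ q : ℕ, 0 < q ∧ q ≤ R ^ Fintype.card ι ∧
      ∃ p : ι → ℤ, ∀ i, |q * β i - p i| ≤ 1 / (R : ℝ) := by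
  classical
  have hR' : (0 : ℝ) < R := by exact_mod_cast hR
  have hlt : ∀ x : ℝ, ⌊(R : ℝ) * Int.fract x⌋₊ < R := fun x => by
    rw [Nat.floor_lt (mul_nonneg hR'.le (Int.fract_nonneg x))]
    nlinarith [Int.fract_lt_one x]
  let f : Fin (R ^ Fintype.card ι + 1) → ι → Fin R :=
    fun q i => ⟨⌊(R : ℝ) * Int.fract ((q : ℕ) * β i)⌋₊, hlt _⟩
  obtain ⟨a, b, hab, hf⟩ := Fintype.exists_ne_map_eq_of_card_lt f (by simp)
  wlog h : a < b generalizing a b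
  · exact this b a hab.symm hf.symm (lt_of_le_of_ne (not_lt.mp h) hab.symm)
  have h' : (a : ℕ) < b := h
  refine ⟨b - a, by omega, by omega, fun i => ⌊((b : ℕ) : ℝ) * β i⌋ - ⌊((a : ℕ) : ℝ) * β i⌋,
    fun i => ?_⟩
  have hfi : ⌊(R : ℝ) * Int.fract ((a : ℕ) * β i)⌋₊ = ⌊(R : ℝ) * Int.fract ((b : ℕ) * β i)⌋₊ := by
    simpa [f] using congrFun hf i
  have ha0 := mul_nonneg hR'.le (Int.fract_nonneg (((a : ℕ) : ℝ) * β i))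
  have hb0 := mul_nonneg hR'.le (Int.fract_nonneg (((b : ℕ) : ℝ) * β i))
  have ha1 := Nat.floor_le ha0
  have hb1 := Nat.floor_le hb0
  have ha2 := Nat.lt_floor_add_one ((R : ℝ) * Int.fract ((a : ℕ) * β i))
  have hb2 := Nat.lt_floor_add_one ((R : ℝ) * Int.fract ((b : ℕ) * β i))
  rw [hfi] at ha1 ha2
  have key : |(R : ℝ) * (Int.fract ((b : ℕ) * β i) - Int.fract ((a : ℕ) * β i))| ≤ 1 := by
    rw [abs_le]; constructor <;> linarith
  rw [abs_mul, abs_of_pos hR'] at key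
  rw [le_div_iff₀ hR', mul_comm]
  refine le_of_eq_of_le ?_ key
  congr 2
  rw [Nat.cast_sub h'.le]
  simp only [Int.fract]
  push_cast
  ring

/-- A good approximation to zero by the linear form `m ↦ ∑ mᵢ αᵢ` yields a good simultaneous
approximation to `α`. -/
theorem exists_simultaneous_of_linearForm {d : ℕ} (α : Fin d → ℝ) (m : Fin d → ℤ) (hm : m ≠ 0)
    (M R : ℕ) (hM : ∀ i, |m i| ≤ M) (hR : 0 < R)
    (h : dn (∑ i, m i * α i) * (R : ℝ) ^ d ≤ 1) :
    ∃ q : ℕ, 0 < q ∧ q ≤ M * R ^ (d - 1) ∧ ∀ i, dn (q * α i) ≤ d * M / R := by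
  classical
  obtain ⟨i₀, hi₀⟩ := Function.ne_iff.mp hm
  have hi₀ : m i₀ ≠ 0 := hi₀
  have hR' : (0 : ℝ) < R := by exact_mod_cast hR
  have hd : 1 ≤ d := by have := i₀.pos; omega
  have hd' : (1 : ℝ) ≤ d := by exact_mod_cast hd
  have hMr : ∀ i, |(m i : ℝ)| ≤ M := fun i => by exact_mod_cast hM i
  have hM1 : 1 ≤ M := by
    have := hM i₀
    have := Int.one_le_abs hi₀
    omega
  have hM1' : (1 : ℝ) ≤ M := by exact_mod_cast hM1
  obtain ⟨q, hq, hqR, p, hp⟩ :=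
    exists_simultaneous_approx (fun i : {i // i ≠ i₀} => α i) R hR
  have hcard : Fintype.card {i // i ≠ i₀} = d - 1 := by
    simp
  rw [hcard] at hqR
  have hna : ((m i₀).natAbs : ℝ) = |(m i₀ : ℝ)| := by
    rw [Nat.cast_natAbs]; push_cast; rfl
  refine ⟨(m i₀).natAbs * q, Nat.mul_pos (Int.natAbs_pos.mpr hi₀) hq,
    Nat.mul_le_mul (by have := hM i₀; rw [Int.abs_eq_natAbs] at this; omega) hqR, fun i => ?_⟩
  by_cases hi : i = i₀
  · subst hi
    have hsgn : dn (((m i).natAbs * q : ℕ) * α i) = dn (m i * q * α i) := by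
      push_cast
      rw [hna]
      rcases abs_choice (m i : ℝ) with h | h
      · rw [h]
      · rw [h, ← dn_neg]; ring_nf
    rw [hsgn]
    refine (dn_le_abs_sub_intCast _
      (q * round (∑ i, m i * α i) - ∑ j : {j // j ≠ i}, m j * p j)).trans ?_
    have hsum : ∑ j, (m j : ℝ) * α j = m i * α i + ∑ j : {j // j ≠ i}, (m j : ℝ) * α j := by
      rw [Fintype.sum_eq_add_sum_subtype_ne _ i]
    have heq : (m i : ℝ) * q * α i -
        ((q * round (∑ i, m i * α i) - ∑ j : {j // j ≠ i}, m j * p j : ℤ) : ℝ) =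
        q * (∑ i, m i * α i - round (∑ i, m i * α i))
          - ∑ j : {j // j ≠ i}, (m j : ℝ) * (q * α j - p j) := by
      push_cast
      simp only [mul_sub, Finset.sum_sub_distrib]
      have : ∑ j : {j // j ≠ i}, (m j : ℝ) * (q * α j)
          = q * ∑ j : {j // j ≠ i}, (m j : ℝ) * α j := by
        rw [Finset.mul_sum]; exact Finset.sum_congr rfl fun _ _ => by ring
      rw [this]
      nth_rewrite 2 [hsum]
      ring
    rw [heq]
    have h1 : |(q : ℝ) * (∑ i, m i * α i - round (∑ i, m i * α i))| ≤ M / R := by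
      rw [abs_mul, Nat.abs_cast]
      change (q : ℝ) * dn _ ≤ _
      rw [le_div_iff₀ hR']
      have hq' : (q : ℝ) ≤ (R : ℝ) ^ (d - 1) := by exact_mod_cast hqR
      calc (q : ℝ) * dn (∑ i, m i * α i) * R ≤ (R : ℝ) ^ (d - 1) * dn (∑ i, m i * α i) * R := by
            gcongr; exact dn_nonneg _
        _ = dn (∑ i, m i * α i) * (R : ℝ) ^ (d - 1 + 1) := by ring
        _ ≤ 1 := by rwa [Nat.sub_add_cancel hd]
        _ ≤ M := hM1'
    have h2 : |∑ j : {j // j ≠ i}, (m j : ℝ) * (q * α j - p j)| ≤ (d - 1) * (M / R) := by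
      refine (Finset.abs_sum_le_sum_abs _ _).trans ?_
      refine (Finset.sum_le_card_nsmul _ _ ((M : ℝ) / R) fun j _ => ?_).trans_eq ?_
      · rw [abs_mul, div_eq_mul_one_div]
        exact mul_le_mul (hMr j) (hp j) (abs_nonneg _) (by positivity)
      · rw [Finset.card_univ, hcard, nsmul_eq_mul, Nat.cast_sub hd, Nat.cast_one]
    calc _ ≤ (M : ℝ) / R + (d - 1) * (M / R) := (abs_sub _ _).trans (add_le_add h1 h2)
      _ = d * M / R := by ring
  · refine (dn_le_abs_sub_intCast _ ((m i₀).natAbs * p ⟨i, hi⟩)).trans ?_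
    have heq : (((m i₀).natAbs * q : ℕ) : ℝ) * α i - (((m i₀).natAbs * p ⟨i, hi⟩ : ℤ) : ℝ)
        = (m i₀).natAbs * (q * α i - p ⟨i, hi⟩) := by
      rw [Int.cast_mul, Int.cast_natCast, Nat.cast_mul]; ring
    rw [heq, abs_mul, hna, abs_abs]
    calc _ ≤ (M : ℝ) * (1 / R) :=
          mul_le_mul (hMr i₀) (hp ⟨i, hi⟩) (abs_nonneg _) (by positivity)
      _ = 1 * M / R := by ring
      _ ≤ d * M / R := by gcongr

/-- If `α` is not too well simultaneously approximable, then the linear form `m ↦ ∑ mᵢ αᵢ`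
satisfies a polynomial lower bound. -/
theorem exists_linearForm_lower_bound {d : ℕ} (hd : 1 ≤ d) (α : Fin d → ℝ) {u c : ℝ} (hu : 0 < u)
    (hud : (d - 1) * u < 1) (hc : 0 < c)
    (h : ∀ n : ℕ, 0 < n → ∃ i, c * (n : ℝ) ^ (-u) ≤ dn (n * α i)) :
    ∃ A B : ℕ, ∀ (M : ℕ) (m : Fin d → ℤ), m ≠ 0 → (∀ i, |m i| ≤ M) →
      1 ≤ dn (∑ i, m i * α i) * ((B : ℝ) * (M : ℝ) ^ A) := by
  set θ : ℝ := 1 - (d - 1) * u with hθ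
  have hθ0 : 0 < θ := by linarith
  obtain ⟨A, hA⟩ := exists_nat_ge ((1 + u) / θ)
  rw [div_le_iff₀ hθ0] at hA
  obtain ⟨B, hBc, hB1⟩ : ∃ B : ℕ, d / c < (B : ℝ) ^ θ ∧ 1 ≤ B :=
    ((((tendsto_rpow_atTop hθ0).comp tendsto_natCast_atTop_atTop).eventually_gt_atTop
      (d / c)).and (eventually_ge_atTop 1)).exists
  refine ⟨A * d, B ^ d, fun M m hm hM => ?_⟩
  by_contra! hlt
  have hM1 : 1 ≤ M := by
    obtain ⟨i, hi⟩ := Function.ne_iff.mp hm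
    have := hM i
    have := Int.one_le_abs (show m i ≠ 0 from hi)
    omega
  have hM0 : (0 : ℝ) < M := by exact_mod_cast hM1
  have hM1' : (1 : ℝ) ≤ M := by exact_mod_cast hM1
  have hB0 : (0 : ℝ) < B := by exact_mod_cast hB1
  have hR : 0 < B * M ^ A := by positivity
  obtain ⟨q, hq, hqle, hdn⟩ := exists_simultaneous_of_linearForm α m hm M (B * M ^ A) hM hR (by
    push_cast
    rw [mul_pow, ← pow_mul]
    push_cast at hlt
    exact hlt.le)
  obtain ⟨i, hi⟩ := h q hq
  have hi := hi.trans (hdn i)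
  set R : ℝ := (B : ℝ) * (M : ℝ) ^ A with hRdef
  have hR0 : 0 < R := by positivity
  have hRc : ((B * M ^ A : ℕ) : ℝ) = R := by push_cast; rfl
  rw [hRc] at hi
  have hq0 : (0 : ℝ) < q := by exact_mod_cast hq
  have hqle' : (q : ℝ) ≤ M * R ^ (d - 1) := by rw [← hRc]; exact_mod_cast hqle
  have h1 : c ≤ d * M / R * (q : ℝ) ^ u := by
    rw [Real.rpow_neg hq0.le] at hi
    have := mul_le_mul_of_nonneg_right hi (Real.rpow_nonneg hq0.le u)
    rwa [mul_assoc, inv_mul_cancel₀ (Real.rpow_pos_of_pos hq0 u).ne', mul_one] at this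
  have h2 : (q : ℝ) ^ u ≤ (M : ℝ) ^ u * (R / R ^ θ) := by
    calc (q : ℝ) ^ u ≤ (M * R ^ (d - 1)) ^ u := Real.rpow_le_rpow hq0.le hqle' hu.le
      _ = (M : ℝ) ^ u * (R / R ^ θ) := by
        rw [Real.mul_rpow hM0.le (by positivity), ← Real.rpow_natCast R, ← Real.rpow_mul hR0.le,
          Nat.cast_sub hd, Nat.cast_one]
        nth_rewrite 2 [← Real.rpow_one R]
        rw [← Real.rpow_sub hR0, hθ]
        ring_nf
  have h3 : R ^ θ ≥ (B : ℝ) ^ θ * (M * (M : ℝ) ^ u) := by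
    rw [hRdef, Real.mul_rpow hB0.le (by positivity), ← Real.rpow_natCast (M : ℝ) A,
      ← Real.rpow_mul hM0.le, ← Real.rpow_one_add' hM0.le (by positivity)]
    gcongr
  have hMu : 0 < (M : ℝ) * (M : ℝ) ^ u := by positivity
  have hRθ : 0 < R ^ θ := by positivity
  have h4 : c ≤ d * (M * (M : ℝ) ^ u) / R ^ θ := by
    calc c ≤ d * M / R * ((M : ℝ) ^ u * (R / R ^ θ)) := h1.trans (by gcongr)
      _ = d * (M * (M : ℝ) ^ u) / R ^ θ := by field_simp
  rw [le_div_iff₀ hRθ] at h4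
  rw [div_lt_iff₀ hc] at hBc
  nlinarith [mul_le_mul_of_nonneg_left h3 hc.le, mul_lt_mul_of_pos_right hBc hMu]

/-- The additive character `x ↦ exp (2πix)`. -/
noncomputable def unitExp (x : ℝ) : ℂ := Complex.exp (Complex.I * ((2 * Real.pi * x : ℝ) : ℂ))

theorem unitExp_add (x y : ℝ) : unitExp (x + y) = unitExp x * unitExp y := by
  rw [unitExp, unitExp, unitExp, ← Complex.exp_add]
  push_cast
  ring_nf

theorem unitExp_natCast_mul (n : ℕ) (x : ℝ) : unitExp (n * x) = unitExp x ^ n := by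
  rw [unitExp, unitExp, ← Complex.exp_nat_mul]
  push_cast
  ring_nf

theorem unitExp_sum {ι : Type*} (s : Finset ι) (f : ι → ℝ) :
    unitExp (∑ i ∈ s, f i) = ∏ i ∈ s, unitExp (f i) := by
  simp only [unitExp, ← Complex.exp_sum, ← Finset.mul_sum]
  push_cast
  rw [Finset.mul_sum]

theorem norm_unitExp (x : ℝ) : ‖unitExp x‖ = 1 := by
  rw [unitExp, mul_comm, Complex.norm_exp_ofReal_mul_I]

theorem conj_unitExp (x : ℝ) : (starRingEnd ℂ) (unitExp x) = unitExp (-x) := by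
  rw [unitExp, unitExp, ← Complex.exp_conj, map_mul, Complex.conj_I, Complex.conj_ofReal]
  push_cast
  ring_nf

theorem four_mul_dn_le_norm_unitExp_sub_one (x : ℝ) : 4 * dn x ≤ ‖unitExp x - 1‖ := by
  have hsin : |Real.sin (Real.pi * x)| = Real.sin (Real.pi * dn x) := by
    have hx : Real.pi * x = Real.pi * (x - round x) + round x * Real.pi := by ring
    have h1 : |Real.sin (Real.pi * x)| = |Real.sin (Real.pi * (x - round x))| := by
      rw [hx, Real.sin_add_int_mul_pi, abs_mul, abs_zpow]
      simp
    have h2 : 0 ≤ Real.sin (Real.pi * dn x) :=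
      Real.sin_nonneg_of_nonneg_of_le_pi (mul_nonneg Real.pi_pos.le (dn_nonneg x))
        (by nlinarith [Real.pi_pos, dn_le_half x])
    rw [h1, ← abs_of_nonneg h2, dn]
    rcases abs_choice (x - round x) with h | h <;> rw [h]
    rw [mul_neg, Real.sin_neg, abs_neg]
  have hle : 2 * dn x ≤ Real.sin (Real.pi * dn x) := by
    have := Real.mul_le_sin (mul_nonneg Real.pi_pos.le (dn_nonneg x))
      (by nlinarith [Real.pi_pos, dn_le_half x])
    have hpi := Real.pi_pos.ne'
    calc 2 * dn x = 2 / Real.pi * (Real.pi * dn x) := by field_simp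
      _ ≤ _ := this
  rw [unitExp, Complex.norm_exp_I_mul_ofReal_sub_one, Real.norm_eq_abs, abs_mul,
    show 2 * Real.pi * x / 2 = Real.pi * x by ring, hsin, abs_two]
  linarith

theorem norm_geom_sum_unitExp_le {x T : ℝ} (h : 1 ≤ dn x * T) (N : ℕ) :
    ‖∑ n ∈ Finset.range N, unitExp x ^ n‖ ≤ T := by
  have hdn : 0 < dn x := (dn_nonneg x).lt_of_ne fun h0 => by
    rw [← h0] at h; norm_num at h
  have hT : 0 < T := pos_of_mul_pos_right (one_pos.trans_le h) hdn.le
  have h4 := four_mul_dn_le_norm_unitExp_sub_one x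
  have h2 : ‖unitExp x ^ N - 1‖ ≤ 2 := by
    refine (norm_sub_le _ _).trans ?_
    rw [norm_pow, norm_unitExp]
    norm_num
  rw [← geom_sum_mul, norm_mul] at h2
  by_contra! hlt
  have : 1 < ‖∑ n ∈ Finset.range N, unitExp x ^ n‖ * dn x := by nlinarith
  nlinarith [norm_nonneg (∑ n ∈ Finset.range N, unitExp x ^ n)]

theorem normSq_one_add_unitExp_div_two_le (x : ℝ) :
    ‖(1 + unitExp x) / 2‖ ^ 2 ≤ 1 - 4 * dn x ^ 2 := by
  have h := parallelogram_law_with_norm ℝ (1 : ℂ) (unitExp x)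
  rw [norm_unitExp, norm_one, norm_sub_rev 1 (unitExp x)] at h
  have h4 := four_mul_dn_le_norm_unitExp_sub_one x
  have h5 := mul_self_le_mul_self (mul_nonneg zero_le_four (dn_nonneg x)) h4
  rw [norm_div, Complex.norm_ofNat]
  nlinarith

/-- A lower bound for the mean square of an exponential polynomial. -/
theorem mean_square_lower_bound {σ : Type*} [DecidableEq σ] (s : Finset σ) (a : σ → ℝ)
    (ha : ∀ j, 0 ≤ a j) (ha1 : ∑ j ∈ s, a j = 1) (b t : σ → ℝ) (N : ℕ) {T : ℝ} (hT : 0 ≤ T)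
    (h : ∀ j ∈ s, ∀ k ∈ s, j ≠ k → ‖∑ n ∈ Finset.range N, unitExp (t j - t k) ^ n‖ ≤ T) :
    (N : ℝ) / s.card - T ≤
      ∑ n ∈ Finset.range N, ‖∑ j ∈ s, (a j : ℂ) * unitExp (n * t j + b j)‖ ^ 2 := by
  have hterm : ∀ n : ℕ, ‖∑ j ∈ s, (a j : ℂ) * unitExp (n * t j + b j)‖ ^ 2 =
      ∑ j ∈ s, ∑ k ∈ s, ((a j * a k : ℝ) * (unitExp (b j - b k) * unitExp (t j - t k) ^ n)).re := by
    intro n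
    have hz : ∀ z : ℂ, ‖z‖ ^ 2 = (z * (starRingEnd ℂ) z).re := fun z => by
      rw [Complex.mul_conj, Complex.normSq_eq_norm_sq]; norm_cast
    rw [hz, map_sum, Finset.sum_mul_sum, Complex.re_sum]
    refine Finset.sum_congr rfl fun j _ => ?_
    rw [Complex.re_sum]
    refine Finset.sum_congr rfl fun k _ => ?_
    congr 1
    rw [map_mul, conj_unitExp, Complex.conj_ofReal, ← unitExp_natCast_mul, ← unitExp_add,
      mul_mul_mul_comm, ← unitExp_add]
    push_cast
    ring_nf
  have hswap : ∑ n ∈ Finset.range N, ‖∑ j ∈ s, (a j : ℂ) * unitExp (n * t j + b j)‖ ^ 2 =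
      ∑ j ∈ s, ∑ k ∈ s, a j * a k *
        (unitExp (b j - b k) * ∑ n ∈ Finset.range N, unitExp (t j - t k) ^ n).re := by
    simp only [hterm]
    rw [Finset.sum_comm]
    refine Finset.sum_congr rfl fun j _ => ?_
    rw [Finset.sum_comm]
    refine Finset.sum_congr rfl fun k _ => ?_
    simp only [Complex.re_ofReal_mul]
    rw [← Finset.mul_sum, ← Complex.re_sum, Finset.mul_sum]
  have hlow : ∀ j ∈ s, ∀ k ∈ s, (if j = k then (N : ℝ) else 0) - T ≤
      (unitExp (b j - b k) * ∑ n ∈ Finset.range N, unitExp (t j - t k) ^ n).re := by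
    intro j hj k hk
    split_ifs with hjk
    · subst hjk
      simp [unitExp, hT]
    · have h1 := Complex.abs_re_le_norm
        (unitExp (b j - b k) * ∑ n ∈ Finset.range N, unitExp (t j - t k) ^ n)
      rw [norm_mul, norm_unitExp, one_mul] at h1
      linarith [neg_le_of_abs_le (h1.trans (h j hj k hk hjk))]
  have hcs : 1 ≤ (s.card : ℝ) * ∑ j ∈ s, a j ^ 2 := by
    have := sq_sum_le_card_mul_sum_sq (s := s) (f := a)
    rwa [ha1, one_pow] at this
  have hcard : (0 : ℝ) < s.card := by
    by_contra! h0
    nlinarith [Finset.sum_nonneg fun j (_ : j ∈ s) => sq_nonneg (a j)]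
  rw [hswap]
  calc (N : ℝ) / s.card - T ≤ N * ∑ j ∈ s, a j ^ 2 - T := by
        rw [div_eq_mul_inv]
        gcongr
        rwa [inv_le_iff_one_le_mul₀' hcard]
    _ = ∑ j ∈ s, ∑ k ∈ s, a j * a k * ((if j = k then (N : ℝ) else 0) - T) := by
        have h1 : ∑ j ∈ s, ∑ k ∈ s, a j * a k * T = T := by
          simp only [← Finset.sum_mul, ← Finset.mul_sum, ha1, one_mul]
        have h2 : ∑ j ∈ s, ∑ k ∈ s, a j * a k * (if j = k then (N : ℝ) else 0)
            = N * ∑ j ∈ s, a j ^ 2 := by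
          rw [Finset.mul_sum]
          refine Finset.sum_congr rfl fun j hj => ?_
          simp only [mul_ite, mul_zero, Finset.sum_ite_eq, hj, if_true]
          ring
        simp only [mul_sub, Finset.sum_sub_distrib, h1, h2]
    _ ≤ _ := Finset.sum_le_sum fun j hj => Finset.sum_le_sum fun k hk =>
        mul_le_mul_of_nonneg_left (hlow j hj k hk) (mul_nonneg (ha j) (ha k))

theorem prod_one_add_unitExp_pow {d : ℕ} (K : ℕ) (x : Fin d → ℝ) :
    ∏ i, ((1 + unitExp (x i)) / 2) ^ K =
      ∑ J ∈ Fintype.piFinset fun _ : Fin d => Finset.range (K + 1),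
        ((∏ i, (K.choose (J i) : ℝ) / 2 ^ K : ℝ) : ℂ) * unitExp (∑ i, J i * x i) := by
  have h : ∀ z : ℂ, ((1 + z) / 2) ^ K =
      ∑ j ∈ Finset.range (K + 1), (K.choose j : ℂ) / 2 ^ K * z ^ j := fun z => by
    rw [div_pow, add_comm, add_pow, Finset.sum_div]
    refine Finset.sum_congr rfl fun j _ => ?_
    rw [one_pow]
    ring
  simp only [h]
  rw [Finset.prod_univ_sum]
  refine Finset.sum_congr rfl fun J _ => ?_
  rw [Finset.prod_mul_distrib, unitExp_sum]
  simp only [unitExp_natCast_mul]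
  push_cast
  rfl

theorem sum_prod_choose_div_two_pow (d K : ℕ) :
    ∑ J ∈ Fintype.piFinset fun _ : Fin d => Finset.range (K + 1),
      ∏ i, (K.choose (J i) : ℝ) / 2 ^ K = 1 := by
  rw [← Finset.prod_univ_sum (fun _ : Fin d => Finset.range (K + 1))
    (fun _ j => (K.choose j : ℝ) / 2 ^ K)]
  refine Finset.prod_eq_one fun _ _ => ?_
  rw [← Finset.sum_div, div_eq_one_iff_eq (by positivity)]
  exact_mod_cast Nat.sum_range_choose K

/-- An effective form of Kronecker's theorem. -/
theorem exists_inhomogeneous_approx {d : ℕ} (α γ : Fin d → ℝ) (K L N : ℕ) (hL : 0 < L) {T : ℝ}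
    (hT : 0 ≤ T)
    (hα : ∀ m : Fin d → ℤ, m ≠ 0 → (∀ i, |m i| ≤ K) → 1 ≤ dn (∑ i, m i * α i) * T)
    (hN : N * Real.exp (-(4 * K / L ^ 2)) < N / ((K : ℝ) + 1) ^ d - T) :
    ∃ n < N, ∀ i, dn (((n + 1 : ℕ) : ℝ) * α i - γ i) < 1 / L := by
  classical
  by_contra! hcon
  have hL' : (0 : ℝ) < L := by exact_mod_cast hL
  have hlow := mean_square_lower_bound
    (Fintype.piFinset fun _ : Fin d => Finset.range (K + 1))
    (fun J => ∏ i, (K.choose (J i) : ℝ) / 2 ^ K)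
    (fun J => Finset.prod_nonneg fun _ _ => by positivity) (sum_prod_choose_div_two_pow d K)
    (fun J => ∑ i, J i * (α i - γ i)) (fun J => ∑ i, J i * α i) N hT (by
      intro J hJ J' hJ' hne
      apply norm_geom_sum_unitExp_le
      have h := hα (fun i => (J i : ℤ) - J' i)
        (fun h0 => hne (funext fun i => by
          have : (J i : ℤ) - J' i = 0 := congrFun h0 i
          omega))
        (fun i => by
          have h1 := Finset.mem_range.mp (Fintype.mem_piFinset.mp hJ i)
          have h2 := Finset.mem_range.mp (Fintype.mem_piFinset.mp hJ' i)
          rw [abs_le]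
          constructor <;> omega)
      rw [← Finset.sum_sub_distrib]
      refine h.trans_eq ?_
      congr 3 with i
      push_cast
      ring)
  have hup : ∀ n ∈ Finset.range N,
      ‖∑ J ∈ Fintype.piFinset fun _ : Fin d => Finset.range (K + 1),
        ((∏ i, (K.choose (J i) : ℝ) / 2 ^ K : ℝ) : ℂ) *
          unitExp (n * (∑ i, J i * α i) + ∑ i, J i * (α i - γ i))‖ ^ 2 ≤
        Real.exp (-(4 * K / L ^ 2)) := by
    intro n hn
    obtain ⟨i₀, hi₀⟩ := hcon n (Finset.mem_range.mp hn)
    have hx : ∀ J : Fin d → ℕ, n * (∑ i, (J i : ℝ) * α i) + ∑ i, (J i : ℝ) * (α i - γ i) =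
        ∑ i, (J i : ℝ) * (((n + 1 : ℕ) : ℝ) * α i - γ i) := fun J => by
      rw [Finset.mul_sum, ← Finset.sum_add_distrib]
      refine Finset.sum_congr rfl fun i _ => ?_
      push_cast
      ring
    simp only [hx]
    rw [← prod_one_add_unitExp_pow K fun i => ((n + 1 : ℕ) : ℝ) * α i - γ i, norm_prod,
      ← Finset.prod_pow]
    have hle1 : ∀ i, ‖((1 + unitExp (((n + 1 : ℕ) : ℝ) * α i - γ i)) / 2) ^ K‖ ^ 2 ≤ 1 := by
      intro i
      rw [norm_pow, ← pow_mul, mul_comm K 2, pow_mul]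
      refine pow_le_one₀ (by positivity) ((normSq_one_add_unitExp_div_two_le _).trans ?_)
      nlinarith [sq_nonneg (dn (((n + 1 : ℕ) : ℝ) * α i - γ i))]
    rw [← Finset.mul_prod_erase _ _ (Finset.mem_univ i₀)]
    refine (mul_le_of_le_one_right (by positivity)
      (Finset.prod_le_one (fun _ _ => by positivity) fun i _ => hle1 i)).trans ?_
    rw [norm_pow, ← pow_mul, mul_comm K 2, pow_mul,
      show -(4 * (K : ℝ) / L ^ 2) = K * -(4 / L ^ 2) by ring, Real.exp_nat_mul]
    refine pow_le_pow_left₀ (by positivity) ?_ K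
    refine ((normSq_one_add_unitExp_div_two_le _).trans ?_).trans (Real.one_sub_le_exp_neg _)
    have h2 : (1 / (L : ℝ)) ^ 2 ≤ dn (((n + 1 : ℕ) : ℝ) * α i₀ - γ i₀) ^ 2 :=
      pow_le_pow_left₀ (by positivity) hi₀ 2
    rw [one_div, inv_pow] at h2
    rw [div_eq_mul_inv]
    linarith
  have hsum := Finset.sum_le_card_nsmul _ _ _ hup
  rw [Finset.card_range, nsmul_eq_mul] at hsum
  rw [Fintype.card_piFinset_const, Finset.card_range] at hlow
  push_cast at hlow hsum
  linarith

theorem eventually_exp_neg_four_mul_le (d : ℕ) :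
    ∀ᶠ L : ℕ in atTop, Real.exp (-(4 * (L : ℝ))) ≤ 1 / (2 * ((L : ℝ) ^ 3 + 1) ^ d) := by
  have h := ((Real.tendsto_pow_mul_exp_neg_atTop_nhds_zero (3 * d)).comp
    tendsto_natCast_atTop_atTop).eventually_le_const
    (show (0 : ℝ) < 1 / (2 * 2 ^ d) by positivity)
  filter_upwards [h, eventually_ge_atTop 1] with L hL hL1
  have hL1' : (1 : ℝ) ≤ L := by exact_mod_cast hL1
  have h3 : (1 : ℝ) ≤ (L : ℝ) ^ 3 := one_le_pow₀ hL1'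
  simp only [Function.comp] at hL
  rw [le_div_iff₀ (by positivity)] at hL ⊢
  calc Real.exp (-(4 * (L : ℝ))) * (2 * ((L : ℝ) ^ 3 + 1) ^ d)
      ≤ Real.exp (-(L : ℝ)) * (2 * (2 * (L : ℝ) ^ 3) ^ d) := by
        gcongr <;> linarith
    _ = (L : ℝ) ^ (3 * d) * Real.exp (-(L : ℝ)) * (2 * 2 ^ d) := by
        rw [mul_pow, ← pow_mul]; ring
    _ ≤ 1 := hL

/-- Effective Kronecker theorem with polynomial dependence on the accuracy. -/
theorem exists_eventually_inhomogeneous_approx {d : ℕ} (α : Fin d → ℝ) (A B : ℕ)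
    (h : ∀ (M : ℕ) (m : Fin d → ℤ), m ≠ 0 → (∀ i, |m i| ≤ M) →
      1 ≤ dn (∑ i, m i * α i) * ((B : ℝ) * (M : ℝ) ^ A)) :
    ∃ E : ℕ, ∀ᶠ L : ℕ in atTop, ∀ γ : Fin d → ℝ, ∃ n : ℕ, 0 < n ∧ n ≤ L ^ E ∧
      ∀ i, dn (n * α i - γ i) < 1 / L := by
  refine ⟨3 * d + 3 * A + 1, ?_⟩
  filter_upwards [eventually_exp_neg_four_mul_le d, eventually_ge_atTop 1,
    eventually_gt_atTop (2 * 2 ^ d * B)] with L hexp hL1 hLB γ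
  have hL1' : (1 : ℝ) ≤ L := by exact_mod_cast hL1
  have hL0 : (0 : ℝ) < L := by linarith
  have h3 : (1 : ℝ) ≤ (L : ℝ) ^ 3 := one_le_pow₀ hL1'
  have hLB' : 2 * 2 ^ d * (B : ℝ) < L := by exact_mod_cast hLB
  obtain ⟨n, hn, hni⟩ := exists_inhomogeneous_approx α γ (L ^ 3) L (L ^ (3 * d + 3 * A + 1)) hL1
    (T := (B : ℝ) * ((L ^ 3 : ℕ) : ℝ) ^ A) (by positivity) (h (L ^ 3)) (by
      push_cast
      have hK : 4 * (L : ℝ) ^ 3 / L ^ 2 = 4 * L := by field_simp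
      rw [hK]
      have hpos : (0 : ℝ) < ((L : ℝ) ^ 3 + 1) ^ d := by positivity
      have h1 : (L : ℝ) ^ (3 * d + 3 * A + 1) * Real.exp (-(4 * (L : ℝ))) ≤
          (L : ℝ) ^ (3 * d + 3 * A + 1) * (1 / (2 * ((L : ℝ) ^ 3 + 1) ^ d)) := by
        gcongr
      have h2 : (B : ℝ) * ((L : ℝ) ^ 3) ^ A <
          (L : ℝ) ^ (3 * d + 3 * A + 1) / (2 * ((L : ℝ) ^ 3 + 1) ^ d) := by
        rw [lt_div_iff₀ (by positivity)]
        calc (B : ℝ) * ((L : ℝ) ^ 3) ^ A * (2 * ((L : ℝ) ^ 3 + 1) ^ d)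
            ≤ (B : ℝ) * ((L : ℝ) ^ 3) ^ A * (2 * (2 * (L : ℝ) ^ 3) ^ d) := by
              gcongr; linarith
          _ = (2 * 2 ^ d * B) * (L : ℝ) ^ (3 * d + 3 * A) := by
              rw [mul_pow, ← pow_mul, ← pow_mul, pow_add]; ring
          _ < L * (L : ℝ) ^ (3 * d + 3 * A) := by gcongr
          _ = _ := by ring
      have h4 : (L : ℝ) ^ (3 * d + 3 * A + 1) / ((L : ℝ) ^ 3 + 1) ^ d =
          (L : ℝ) ^ (3 * d + 3 * A + 1) * (1 / (2 * ((L : ℝ) ^ 3 + 1) ^ d)) +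
          (L : ℝ) ^ (3 * d + 3 * A + 1) / (2 * ((L : ℝ) ^ 3 + 1) ^ d) := by
        field_simp
        ring
      linarith)
  exact ⟨n + 1, n.succ_pos, hn, hni⟩

theorem exists_const_le_prod_dn {d : ℕ} (α : Fin d → ℝ) {w : ℝ}
    (hw : multExp α < (w : EReal)) :
    ∃ c : ℝ, 0 < c ∧ c ≤ 1 ∧ ∀ n : ℕ, 0 < n → c * (n : ℝ) ^ (-w) ≤ ∏ i, dn (n * α i) := by
  have hfin : {n : ℕ | 0 < n ∧ ∏ i, dn (n * α i) < (n : ℝ) ^ (-w)}.Finite := by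
    by_contra hinf
    exact hw.not_ge (le_sSup ⟨w, rfl, hinf⟩)
  have hpos : ∀ n : ℕ, 0 < n → 0 < ∏ i, dn (n * α i) := by
    intro n hn
    refine (Finset.prod_nonneg fun i _ => dn_nonneg _).lt_of_ne fun h0 => ?_
    obtain ⟨i, -, hi⟩ := Finset.prod_eq_zero_iff.mp h0.symm
    have hint : (n : ℝ) * α i = round ((n : ℝ) * α i) := by
      rw [dn, abs_eq_zero, sub_eq_zero] at hi
      exact hi
    refine (Set.infinite_of_injective_forall_mem (f := fun k : ℕ => (k + 1) * n)
      (fun a b hab => ?_) fun k => ?_) hfin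
    · have := Nat.eq_of_mul_eq_mul_right hn hab
      omega
    · have hk : 0 < (k + 1) * n := Nat.mul_pos k.succ_pos hn
      refine ⟨hk, ?_⟩
      have hz : dn (((k + 1) * n : ℕ) * α i) = 0 := by
        refine le_antisymm ((dn_le_abs_sub_intCast _ ((k + 1) * round ((n : ℝ) * α i))).trans_eq ?_)
          (dn_nonneg _)
        push_cast
        rw [← hint, abs_eq_zero]
        ring
      rw [Finset.prod_eq_zero (Finset.mem_univ i) hz]
      exact Real.rpow_pos_of_pos (by exact_mod_cast hk) _
  obtain ⟨c, hc0, hc⟩ : ∃ c : ℝ, 0 < c ∧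
      ∀ n ∈ hfin.toFinset, c * (n : ℝ) ^ (-w) ≤ ∏ i, dn (n * α i) := by
    have hev : ∀ n ∈ hfin.toFinset, ∀ᶠ c : ℝ in nhdsWithin 0 (Set.Ioi 0),
        c * (n : ℝ) ^ (-w) ≤ ∏ i, dn (n * α i) := by
      intro n hn
      have hn0 : 0 < n := ((Set.Finite.mem_toFinset hfin).mp hn).1
      have ht : Tendsto (fun c : ℝ => c * (n : ℝ) ^ (-w)) (nhdsWithin 0 (Set.Ioi 0)) (nhds 0) := by
        refine Tendsto.mono_left ?_ nhdsWithin_le_nhds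
        simpa using (continuous_mul_const ((n : ℝ) ^ (-w))).tendsto 0
      exact ht.eventually_le_const (hpos n hn0)
    obtain ⟨c, hc, hc0⟩ :=
      (((Finset.eventually_all _).mpr hev).and self_mem_nhdsWithin).exists
    exact ⟨c, hc0, hc⟩
  refine ⟨min c 1, lt_min hc0 one_pos, min_le_right _ _, fun n hn => ?_⟩
  have hnw : 0 ≤ (n : ℝ) ^ (-w) := Real.rpow_nonneg n.cast_nonneg _
  by_cases hmem : n ∈ hfin.toFinset
  · exact (mul_le_mul_of_nonneg_right (min_le_left _ _) hnw).trans (hc n hmem)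
  · rw [Set.Finite.mem_toFinset] at hmem
    have : (n : ℝ) ^ (-w) ≤ ∏ i, dn (n * α i) := by
      by_contra! hlt
      exact hmem ⟨hn, hlt⟩
    exact (mul_le_of_le_one_left hnw (min_le_right _ _)).trans this

theorem exists_const_le_dn {d : ℕ} (hd : 1 ≤ d) (α : Fin d → ℝ) {w : ℝ}
    (hw : multExp α < (w : EReal)) :
    ∃ c : ℝ, 0 < c ∧ ∀ n : ℕ, 0 < n → ∃ i, c * (n : ℝ) ^ (-(w / d)) ≤ dn (n * α i) := by
  obtain ⟨c, hc0, hc1, hc⟩ := exists_const_le_prod_dn α hw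
  refine ⟨c / 2, by positivity, fun n hn => ?_⟩
  by_contra! hlt
  have hn0 : (0 : ℝ) < n := by exact_mod_cast hn
  have hd0 : (d : ℝ) ≠ 0 := by positivity
  have h1 : ∏ i, dn (n * α i) ≤ (c / 2 * (n : ℝ) ^ (-(w / d))) ^ d := by
    refine (Finset.prod_le_prod (fun i _ => dn_nonneg _) fun i _ => (hlt i).le).trans_eq ?_
    simp
  rw [mul_pow, ← Real.rpow_mul_natCast hn0.le, neg_mul, div_mul_cancel₀ _ hd0] at h1
  have h2 : (c / 2) ^ d ≤ c / 2 := pow_le_of_le_one (by positivity) (by linarith) (by omega)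
  have h3 : 0 < (n : ℝ) ^ (-w) := Real.rpow_pos_of_pos hn0 _
  nlinarith [hc n hn, mul_le_mul_of_nonneg_right h2 h3.le]

theorem le_unifExp_of_eventually {d : ℕ} (α γ : Fin d → ℝ) (E : ℕ)
    (h : ∀ᶠ L : ℕ in atTop, ∃ n : ℕ, 0 < n ∧ n ≤ L ^ E ∧ ∀ i, dn (n * α i - γ i) < 1 / L) :
    ((1 / (2 * (E + 1)) : ℝ) : EReal) ≤ unifExp α γ := by
  set c : ℝ := 1 / (2 * (E + 1)) with hc
  have hc0 : 0 < c := by positivity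
  refine le_sSup ⟨c, rfl, ?_⟩
  obtain ⟨X₀, hX₀⟩ := eventually_atTop.mp
    (((tendsto_nat_ceil_atTop.comp (tendsto_rpow_atTop hc0)).eventually h).and
      (((tendsto_rpow_atTop hc0).eventually_ge_atTop 2).and (eventually_gt_atTop 0)))
  refine ⟨X₀, fun X hX => ?_⟩
  obtain ⟨⟨n, hn, hnL, hni⟩, hX2, hX0⟩ := hX₀ X hX
  simp only [Function.comp] at hnL hni
  have hceil := Nat.le_ceil (X ^ c)
  have hceil' := Nat.ceil_lt_add_one (show 0 ≤ X ^ c by linarith)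
  have hL2 : (2 : ℝ) ≤ ⌈X ^ c⌉₊ := hX2.trans hceil
  refine ⟨n, hn, ?_, fun i => (hni i).trans_le ?_⟩
  · calc (n : ℝ) ≤ (⌈X ^ c⌉₊ : ℝ) ^ E := by exact_mod_cast hnL
      _ < (⌈X ^ c⌉₊ : ℝ) ^ (E + 1) := pow_lt_pow_right₀ (by linarith) (Nat.lt_succ_self E)
      _ ≤ ((X ^ c) ^ 2) ^ (E + 1) := by
        gcongr
        nlinarith
      _ = X := by
        rw [← pow_mul, ← Real.rpow_mul_natCast hX0.le, hc]
        push_cast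
        rw [one_div_mul_cancel (by positivity), Real.rpow_one]
  · rw [Real.rpow_neg hX0.le, ← one_div]
    exact one_div_le_one_div_of_le (by linarith) hceil

/-- If `d ≥ 1` and `ω^×(α) < d/(d-1)` (read as `ω^×(α) < ∞` for `d = 1`), then there is
`c > 0`, depending only on `α`, such that `ω̂(α, γ) ≥ c` for every `γ ∈ ℝ^d`. -/
theorem unifExp_pos_lower_bound (d : ℕ) (hd : 1 ≤ d) (α : Fin d → ℝ)
    (hα : multExp α <
      (if d = 1 then (⊤ : EReal) else ((((d : ℝ)) / ((d : ℝ) - 1) : ℝ) : EReal))) :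
    ∃ c : ℝ, 0 < c ∧ ∀ γ : Fin d → ℝ, ((c : ℝ) : EReal) ≤ unifExp α γ := by
  obtain ⟨w, hw, hw0, hwd⟩ : ∃ w : ℝ, multExp α < (w : EReal) ∧ 0 < w ∧ (d - 1) * w < d := by
    split_ifs at hα with h1
    · obtain ⟨w, hw, -⟩ := EReal.lt_iff_exists_real_btwn.mp hα
      refine ⟨max w 1, hw.trans_le (EReal.coe_le_coe_iff.mpr (le_max_left _ _)), by positivity, ?_⟩
      simp [h1]
    · have hd1 : (0 : ℝ) < d - 1 := by
        rw [sub_pos]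
        exact_mod_cast lt_of_le_of_ne hd (Ne.symm h1)
      have h0 : ((0 : ℝ) : EReal) < ((d / (d - 1) : ℝ) : EReal) :=
        EReal.coe_lt_coe_iff.mpr (by positivity)
      obtain ⟨w, hw, hw'⟩ := EReal.lt_iff_exists_real_btwn.mp (max_lt hα h0)
      refine ⟨w, (le_max_left _ _).trans_lt hw,
        EReal.coe_lt_coe_iff.mp ((le_max_right _ _).trans_lt hw), ?_⟩
      rw [mul_comm, ← lt_div_iff₀ hd1]
      exact EReal.coe_lt_coe_iff.mp hw'
  have hd0 : (0 : ℝ) < d := by exact_mod_cast hd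
  obtain ⟨c, hc0, hc⟩ := exists_const_le_dn hd α hw
  obtain ⟨A, B, hAB⟩ := exists_linearForm_lower_bound hd α (u := w / d) (by positivity)
    (by rwa [← mul_div_assoc, div_lt_one hd0]) hc0 hc
  obtain ⟨E, hE⟩ := exists_eventually_inhomogeneous_approx α A B hAB
  exact ⟨1 / (2 * (E + 1)), by positivity, fun γ =>
    le_unifExp_of_eventually α γ E (hE.mono fun L hL => hL γ)⟩
end

section
/- Let k be a positive integer and let P = P^+(b; A_1, …, A_k; N_1, …, N_k) be a proper generalised arithmetic progression with gcd(A_1, …, A_k) = 1. Then there is a constant C depending only on k such that for every prime p, the number of elements of P divisible by p is at most C (1/p + 1/min{N_1,…,N_k}) · N_1 ⋯ N_k. -/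
open scoped BigOperators
open Filter MeasureTheory

/-- The generalised arithmetic progression
`P^+(b; A₁,…,A_k; N₁,…,N_k) = {b + A₁n₁ + ⋯ + A_k n_k : 1 ≤ n_i ≤ N_i}`. -/
def GAPplus {k : ℕ} (b : ℕ) (A Nl : Fin k → ℕ) : Set ℤ :=
  {m : ℤ | ∃ n : Fin k → ℕ, (∀ i, 1 ≤ n i ∧ n i ≤ Nl i) ∧
    m = (b : ℤ) + ∑ i, (A i : ℤ) * (n i : ℤ)}

/-- `P^+(b; A; N)` is proper if each of its elements has a unique representation. -/
def GAPProper {k : ℕ} (b : ℕ) (A Nl : Fin k → ℕ) : Prop :=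
  ∀ n m : Fin k → ℕ, (∀ i, 1 ≤ n i ∧ n i ≤ Nl i) → (∀ i, 1 ≤ m i ∧ m i ≤ Nl i) →
    (b : ℤ) + ∑ i, (A i : ℤ) * (n i : ℤ) = (b : ℤ) + ∑ i, (A i : ℤ) * (m i : ℤ) → n = m

/-- If `p` is a prime not dividing `A j`, then, the other coordinates being fixed, the points `n`
of a box with `p ∣ b + ∑ A i * n i` have their `j`-th coordinate in one residue class mod `p`. -/
theorem card_box_filter_dvd_le {k : ℕ} (b : ℤ) (A Nl : Fin k → ℕ) {p : ℕ} (hp : p.Prime)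
    (j : Fin k) (hj : ¬ p ∣ A j) :
    ((Fintype.piFinset fun i => Finset.Icc 1 (Nl i)).filter
      fun n => (p : ℤ) ∣ b + ∑ i, (A i : ℤ) * (n i : ℤ)).card ≤
      (Nl j / p + 1) * ∏ i ∈ Finset.univ \ {j}, Nl i := by
  have hcard : (Fintype.piFinset
      (Function.update (fun i => Finset.Icc 1 (Nl i)) j {1})).card =
      ∏ i ∈ Finset.univ \ {j}, Nl i := by
    rw [Fintype.card_piFinset, ← Finset.mul_prod_erase _ _ (Finset.mem_univ j),
      Finset.sdiff_singleton_eq_erase]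
    simp only [Function.update_self, Finset.card_singleton, one_mul]
    refine Finset.prod_congr rfl fun i hi => ?_
    rw [Function.update_of_ne (Finset.ne_of_mem_erase hi), Nat.card_Icc, Nat.add_sub_cancel]
  rw [← hcard]
  refine Finset.card_le_mul_card_image_of_maps_to (f := fun n => Function.update n j 1) ?_ _ ?_
  · intro n hn
    simp only [Finset.mem_filter, Fintype.mem_piFinset] at hn ⊢
    intro i
    by_cases h : i = j
    · subst h; simp
    · simpa [Function.update_of_ne h] using hn.1 i
  · intro c _
    rw [← Finset.card_range (Nl j / p + 1)]
    refine Finset.card_le_card_of_injOn (fun n => n j / p) ?_ ?_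
    · intro n hn
      simp only [Finset.coe_filter, Finset.mem_filter, Fintype.mem_piFinset, Set.mem_ofPred_eq,
        Finset.mem_Icc] at hn
      simpa [Nat.lt_succ_iff] using Nat.div_le_div_right (hn.1.1 j).2
    · intro n hn m hm hnm
      simp only [Finset.coe_filter, Finset.mem_filter, Set.mem_ofPred_eq] at hn hm
      have hne : ∀ i, i ≠ j → n i = m i := fun i hi => by
        simpa [Function.update_of_ne hi] using congrFun (hn.2.trans hm.2.symm) i
      have hdvd : (p : ℤ) ∣ (A j : ℤ) * ((n j : ℤ) - m j) := by
        have h := dvd_sub hn.1.2 hm.1.2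
        rw [add_sub_add_left_eq_sub, ← Finset.sum_sub_distrib,
          Finset.sum_eq_single_of_mem j (Finset.mem_univ j)
            (fun i _ hi => by rw [hne i hi, sub_self])] at h
        rwa [mul_sub]
      have hmod : n j % p = m j % p := by
        rcases (Nat.prime_iff_prime_int.mp hp).dvd_or_dvd hdvd with h | h
        · exact absurd (Int.natCast_dvd_natCast.mp h) hj
        · exact ((Nat.modEq_iff_dvd.mpr h).symm : n j ≡ m j [MOD p])
      funext i
      by_cases hi : i = j
      · subst hi
        have hdiv : n i / p = m i / p := hnm
        rw [← Nat.div_add_mod (n i) p, ← Nat.div_add_mod (m i) p, hdiv, hmod]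
      · exact hne i hi

/-- For a proper GAP `P = P⁺(b; A₁,…,A_k; N₁,…,N_k)` with `gcd(A₁,…,A_k) = 1`, there is a
constant `C` depending only on `k` such that for every prime `p` the number of elements
of `P` divisible by `p` is at most `C (1/p + 1/min_i N_i) N₁⋯N_k`. -/
theorem gap_divisibility_count (k : ℕ) (hk : 0 < k) :
    ∃ C : ℝ, 0 < C ∧
      ∀ (b : ℕ) (A Nl : Fin k → ℕ), 0 < b → (∀ i, 0 < A i) → (∀ i, 0 < Nl i) →
        GAPProper b A Nl → Finset.univ.gcd A = 1 →
        ∀ p : ℕ, p.Prime →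
          (({m : ℤ | m ∈ GAPplus b A Nl ∧ (p : ℤ) ∣ m}).ncard : ℝ) ≤
            C * ((1 / (p : ℝ) + 1 / ((sInf (Set.range Nl) : ℕ) : ℝ)) *
              ∏ i, (Nl i : ℝ)) := by
  refine ⟨1, one_pos, fun b A Nl _ _ hN _ hgcd p hp => ?_⟩
  obtain ⟨j, hj⟩ : ∃ j, ¬ p ∣ A j := by
    by_contra! h
    exact hp.one_lt.ne' (Nat.dvd_one.mp (hgcd ▸ Finset.dvd_gcd fun i _ => h i))
  set T := (Fintype.piFinset fun i => Finset.Icc 1 (Nl i)).filter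
    fun n => (p : ℤ) ∣ (b : ℤ) + ∑ i, (A i : ℤ) * (n i : ℤ)
  have hsub : {m : ℤ | m ∈ GAPplus b A Nl ∧ (p : ℤ) ∣ m} ⊆
      (T.image fun n => (b : ℤ) + ∑ i, (A i : ℤ) * (n i : ℤ) : Finset ℤ) := by
    rintro m ⟨⟨n, hn, rfl⟩, hdvd⟩
    refine Finset.mem_coe.mpr (Finset.mem_image_of_mem _ ?_)
    simpa [T, hdvd] using hn
  have hcount : {m : ℤ | m ∈ GAPplus b A Nl ∧ (p : ℤ) ∣ m}.ncard ≤
      (Nl j / p + 1) * ∏ i ∈ Finset.univ \ {j}, Nl i := by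
    refine (Set.ncard_le_ncard hsub (Finset.finite_toSet _)).trans ?_
    rw [Set.ncard_coe_finset]
    exact Finset.card_image_le.trans (card_box_filter_dvd_le b A Nl hp j hj)
  have hmin_pos : 0 < sInf (Set.range Nl) := by
    obtain ⟨i, hi⟩ := Nat.sInf_mem (⟨Nl j, j, rfl⟩ : (Set.range Nl).Nonempty)
    exact hi ▸ hN i
  have hmin_le : sInf (Set.range Nl) ≤ Nl j := Nat.sInf_le ⟨j, rfl⟩
  have hNj : (0 : ℝ) < Nl j := Nat.cast_pos.mpr (hN j)
  have hprod : ∏ i, (Nl i : ℝ) = Nl j * ∏ i ∈ Finset.univ \ {j}, (Nl i : ℝ) := by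
    rw [Finset.sdiff_singleton_eq_erase,
      Finset.mul_prod_erase _ (fun i => (Nl i : ℝ)) (Finset.mem_univ j)]
  calc ({m : ℤ | m ∈ GAPplus b A Nl ∧ (p : ℤ) ∣ m}.ncard : ℝ)
      ≤ (((Nl j / p : ℕ) : ℝ) + 1) * ∏ i ∈ Finset.univ \ {j}, (Nl i : ℝ) := by
        exact_mod_cast hcount
    _ ≤ ((Nl j : ℝ) / p + 1) * ∏ i ∈ Finset.univ \ {j}, (Nl i : ℝ) := by
        gcongr
        exact Nat.cast_div_le
    _ = (1 / (p : ℝ) + 1 / (Nl j : ℝ)) * ∏ i, (Nl i : ℝ) := by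
        rw [hprod]
        field_simp
    _ ≤ 1 * ((1 / (p : ℝ) + 1 / ((sInf (Set.range Nl) : ℕ) : ℝ)) * ∏ i, (Nl i : ℝ)) := by
        rw [one_mul]
        gcongr
end
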